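/- Proposition 1 (Convergence of Beliefs): Let K ≥ 1, fix an index i with 1 ≤ i ≤ K, and fix real sequences (u_k^n)_{n ∈ ℕ} and (v_k^n)_{n ∈ ℕ} for each k = 1,…,K. Let Ω = ({−1,1}²)^ℕ, equipped with the product probability measure P_i whose n-th coordinate distribution assigns to each outcome y = (y^c, y^s) ∈ {−1,1}² the probability σ(y^c·u_i^n)·σ(y^s·v_i^n). Given a probability vector q^0 = (q_1^0,…,q_K^0) with q_j^0 > 0 for all j, define recursively q_k^{n+1}(ω) = q_k^n(ω)·σ̃_k^n(ω_{n+1}) / Σ_{j=1}^K q_j^n(ω)·σ̃_j^n(ω_{n+1}), where σ̃_k^n(y) = σ(y^c·u_k^n)·σ(y^s·v_k^n) and ω_{n+1} is the (n+1)-st coordinate of ω. Then for every k = 1,…,K, the sequence (q_k^n(ω))_{n ∈ ℕ} converges as n → ∞ for P_i-almost every ω ∈ Ω. -/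

import Mathlib

open MeasureTheory

/-- The logistic function `σ(h) = 1/(1 + exp(-h))`. -/
noncomputable def sig (h : ℝ) : ℝ := 1 / (1 + Real.exp (-h))

/-- Encoding of an element of `{-1, 1}` by a Boolean: `true ↦ 1`, `false ↦ -1`. -/
def pm (b : Bool) : ℝ := if b then 1 else -1

/-- The likelihood `σ̃(y) = σ(y^c · u) · σ(y^s · v)` of the pair outcome
`y = (y^c, y^s) ∈ {-1,1}²` under the model with parameters `(u, v)`. -/
noncomputable def lik (u v : ℝ) (y : Bool × Bool) : ℝ :=
  sig (pm y.1 * u) * sig (pm y.2 * v)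

/-- The sample space `Ω = ({-1,1}²)^ℕ` of infinite sequences of pair outcomes. -/
abbrev TLOmega : Type := ℕ → Bool × Bool

/-- The sequence of posterior beliefs: `qproc u v q0 n ω k` is the posterior probability
`q_k^n(ω)` of the `k`-th candidate model after the first `n` observations, obtained by
Bayesian updating from the prior `q0` via
`q_k^{n+1}(ω) = q_k^n(ω)·σ̃_k^n(ω_{n+1}) / Σ_j q_j^n(ω)·σ̃_j^n(ω_{n+1})`. -/
noncomputable def qproc {K : ℕ} (u v : ℕ → Fin K → ℝ) (q0 : Fin K → ℝ) :
    ℕ → TLOmega → Fin K → ℝ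
  | 0, _, k => q0 k
  | n + 1, ω, k =>
      qproc u v q0 n ω k * lik (u n k) (v n k) (ω n) /
        ∑ j, qproc u v q0 n ω j * lik (u n j) (v n j) (ω n)

section LikelihoodRatio

variable {α : Type*}

/-- The likelihood ratio of `r` against `p` along the first `n` coordinates of `ω`. -/
noncomputable def likelihoodRatio (r p : ℕ → α → ℝ) (n : ℕ) (ω : ℕ → α) : ℝ :=
  ∏ m : Fin n, r m (ω m) / p m (ω m)

/-- The filtration on sequences whose `n`-th term is generated by the first `n` coordinates. -/
def prefixFiltration (α : Type*) [MeasurableSpace α] :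
    Filtration ℕ (inferInstance : MeasurableSpace (ℕ → α)) where
  seq n := MeasurableSpace.comap (fun (ω : ℕ → α) (m : Fin n) => ω m) inferInstance
  mono' n k hnk := by
    have h : (fun (ω : ℕ → α) (m : Fin n) => ω m) =
        (fun (s : Fin k → α) (m : Fin n) => s (Fin.castLE hnk m)) ∘
          fun (ω : ℕ → α) (m : Fin k) => ω m := rfl
    change MeasurableSpace.comap _ _ ≤ MeasurableSpace.comap _ _
    rw [h, ← MeasurableSpace.comap_comp]
    exact MeasurableSpace.comap_mono (Measurable.comap_le (by fun_prop))
  le' n := Measurable.comap_le (by fun_prop)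

lemma likelihoodRatio_succ (r p : ℕ → α → ℝ) (n : ℕ) (ω : ℕ → α) :
    likelihoodRatio r p (n + 1) ω = likelihoodRatio r p n ω * (r n (ω n) / p n (ω n)) := by
  simp only [likelihoodRatio, Fin.prod_univ_castSucc, Fin.val_castSucc, Fin.val_last]

lemma likelihoodRatio_nonneg {r p : ℕ → α → ℝ} (hr : ∀ n y, 0 ≤ r n y) (hp : ∀ n y, 0 < p n y)
    (n : ℕ) (ω : ℕ → α) : 0 ≤ likelihoodRatio r p n ω :=
  Finset.prod_nonneg fun m _ => div_nonneg (hr m _) (hp m _).le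

lemma likelihoodRatio_self {p : ℕ → α → ℝ} (hp : ∀ n y, 0 < p n y) (n : ℕ) (ω : ℕ → α) :
    likelihoodRatio p p n ω = 1 :=
  Finset.prod_eq_one fun m _ => div_self (hp m _).ne'

variable [Fintype α] [MeasurableSpace α] [MeasurableSingletonClass α]
  {P : Measure (ℕ → α)} [IsProbabilityMeasure P] {r p : ℕ → α → ℝ}

lemma integrable_prefix {n : ℕ} (g : (Fin n → α) → ℝ) :
    Integrable (fun ω : ℕ → α => g fun m => ω m) P :=
  (Integrable.of_finite (μ := P.map fun (ω : ℕ → α) (m : Fin n) => ω m)).comp_measurable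
    (by fun_prop)

/-- Functions of the first `n` coordinates integrate to a finite sum over prefixes. -/
lemma integral_prefix (hp : ∀ n y, 0 < p n y)
    (hP : ∀ (n : ℕ) (s : Fin n → α),
      P {ω | ∀ m : Fin n, ω m = s m} = ∏ m : Fin n, ENNReal.ofReal (p m (s m)))
    {n : ℕ} (g : (Fin n → α) → ℝ) :
    ∫ ω, g (fun m => ω m) ∂P = ∑ s, (∏ m : Fin n, p m (s m)) * g s := by
  have hmeas : Measurable fun (ω : ℕ → α) (m : Fin n) => ω m := by fun_prop
  have : IsProbabilityMeasure (P.map fun (ω : ℕ → α) (m : Fin n) => ω m) :=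
    Measure.isProbabilityMeasure_map hmeas.aemeasurable
  rw [← integral_map (φ := fun (ω : ℕ → α) (m : Fin n) => ω m) (f := g) hmeas.aemeasurable
    (measurable_of_finite g).aestronglyMeasurable, integral_fintype Integrable.of_finite]
  refine Finset.sum_congr rfl fun s _ => ?_
  rw [smul_eq_mul, measureReal_def, Measure.map_apply hmeas (measurableSet_singleton s)]
  have h : (fun (ω : ℕ → α) (m : Fin n) => ω m) ⁻¹' {s} = {ω | ∀ m : Fin n, ω m = s m} := by
    ext ω
    simp [funext_iff]
  rw [h, hP, ENNReal.toReal_prod]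
  simp only [ENNReal.toReal_ofReal (hp _ _).le]

/-- Likelihood ratios form a martingale under the reference model. -/
lemma martingale_likelihoodRatio (hp : ∀ n y, 0 < p n y) (hr : ∀ n, ∑ y, r n y = 1)
    (hP : ∀ (n : ℕ) (s : Fin n → α),
      P {ω | ∀ m : Fin n, ω m = s m} = ∏ m : Fin n, ENNReal.ofReal (p m (s m))) :
    Martingale (likelihoodRatio r p) (prefixFiltration α) P := by
  refine martingale_of_setIntegral_eq_succ (fun n => ?_)
    (fun n => integrable_prefix (n := n) fun s => ∏ m : Fin n, r m (s m) / p m (s m)) ?_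
  · exact ((measurable_of_finite fun s : Fin n → α => ∏ m : Fin n, r m (s m) / p m (s m)).comp
      (comap_measurable _)).stronglyMeasurable
  · rintro n A ⟨S, -, rfl⟩
    have hA : MeasurableSet ((fun (ω : ℕ → α) (m : Fin n) => ω m) ⁻¹' S) :=
      (show Measurable fun (ω : ℕ → α) (m : Fin n) => ω m by fun_prop) S.toFinite.measurableSet
    rw [← integral_indicator hA, ← integral_indicator hA]
    have hleft := integral_prefix hp hP (n := n)
      (S.indicator fun s => ∏ m : Fin n, r m (s m) / p m (s m))
    have hright := integral_prefix hp hP (n := n + 1)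
      (fun s => S.indicator (fun _ => ∏ m : Fin (n + 1), r m (s m) / p m (s m))
        (fun m : Fin n => s m.castSucc))
    have hcancel : ∀ (k : ℕ) (s : Fin k → α),
        (∏ m : Fin k, p m (s m)) * ∏ m : Fin k, r m (s m) / p m (s m) =
          ∏ m : Fin k, r m (s m) := fun k s => by
      rw [← Finset.prod_mul_distrib]
      exact Finset.prod_congr rfl fun m _ => mul_div_cancel₀ _ (hp _ _).ne'
    refine (hleft.trans ?_).trans hright.symm
    rw [← (Fin.snocEquiv fun _ : Fin (n + 1) => α).sum_comp, Fintype.sum_prod_type_right]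
    refine Finset.sum_congr rfl fun s _ => ?_
    by_cases hs : s ∈ S
    · simp only [Fin.snocEquiv_apply, Fin.snoc_castSucc, Set.indicator_of_mem hs, hcancel]
      simp only [Fin.prod_univ_castSucc, Fin.snoc_castSucc, Fin.snoc_last, Fin.val_castSucc,
        Fin.val_last, ← Finset.mul_sum, hr, mul_one]
    · simp [hs]

/-- Likelihood ratios converge almost surely under the reference model. -/
lemma ae_tendsto_likelihoodRatio (hp : ∀ n y, 0 < p n y) (hr : ∀ n, ∑ y, r n y = 1)
    (hr0 : ∀ n y, 0 ≤ r n y)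
    (hP : ∀ (n : ℕ) (s : Fin n → α),
      P {ω | ∀ m : Fin n, ω m = s m} = ∏ m : Fin n, ENNReal.ofReal (p m (s m))) :
    ∀ᵐ ω ∂P, ∃ L, Filter.Tendsto (fun n => likelihoodRatio r p n ω) Filter.atTop (nhds L) := by
  have hmart := martingale_likelihoodRatio hp hr hP
  refine hmart.submartingale.exists_ae_tendsto_of_bdd (R := 1) fun n => ?_
  have hint : ∫ ω, likelihoodRatio r p n ω ∂P = 1 := by
    have h := hmart.setIntegral_eq (Nat.zero_le n) MeasurableSet.univ
    simpa [likelihoodRatio] using h.symm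
  rw [eLpNorm_one_eq_lintegral_enorm,
    ← ofReal_integral_norm_eq_lintegral_enorm (hmart.integrable n)]
  simp [abs_of_nonneg (likelihoodRatio_nonneg hr0 hp n _), hint]

end LikelihoodRatio

lemma sig_pos (h : ℝ) : 0 < sig h := by
  unfold sig
  positivity

lemma sig_add_sig_neg (h : ℝ) : sig h + sig (-h) = 1 := by
  unfold sig
  rw [neg_neg, Real.exp_neg]
  field_simp
  ring

lemma lik_pos (u v : ℝ) (y : Bool × Bool) : 0 < lik u v y :=
  mul_pos (sig_pos _) (sig_pos _)

lemma sum_lik (u v : ℝ) : ∑ y, lik u v y = 1 := by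
  simp only [lik, Fintype.sum_prod_type, Fintype.sum_bool, pm, if_true, Bool.false_eq_true,
    if_false, one_mul, neg_one_mul]
  linear_combination (sig u + sig (-u)) * sig_add_sig_neg v + sig_add_sig_neg u

/-- Bayes' rule in closed form: the posterior is the normalised product of the prior and the
likelihood ratios against any fixed model `i`. -/
lemma qproc_eq {K : ℕ} (i : Fin K) (u v : ℕ → Fin K → ℝ) {q0 : Fin K → ℝ}
    (hq0 : ∀ j, 0 < q0 j) (hsum : ∑ j, q0 j = 1) (n : ℕ) (ω : TLOmega) (k : Fin K) :
    qproc u v q0 n ω k =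
      q0 k * likelihoodRatio (fun m => lik (u m k) (v m k)) (fun m => lik (u m i) (v m i)) n ω /
        ∑ j, q0 j *
          likelihoodRatio (fun m => lik (u m j) (v m j)) (fun m => lik (u m i) (v m i)) n ω := by
  induction n generalizing k with
  | zero => simp [qproc, likelihoodRatio, hsum]
  | succ n ih =>
    simp only [qproc, ih, likelihoodRatio_succ]
    set X : Fin K → ℝ := fun j =>
      likelihoodRatio (fun m => lik (u m j) (v m j)) (fun m => lik (u m i) (v m i)) n ω
    have hX : ∀ j, 0 ≤ X j := fun j =>
      likelihoodRatio_nonneg (fun _ _ => (lik_pos _ _ _).le) (fun _ _ => lik_pos _ _ _) n ω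
    have hXi : X i = 1 := likelihoodRatio_self (fun _ _ => lik_pos _ _ _) n ω
    have hS : 0 < ∑ j, q0 j * X j :=
      Finset.sum_pos' (fun j _ => mul_nonneg (hq0 j).le (hX j))
        ⟨i, Finset.mem_univ i, by rw [hXi, mul_one]; exact hq0 i⟩
    have hi := (lik_pos (u n i) (v n i) (ω n)).ne'
    have h₁ : ∑ j, q0 j * X j / (∑ l, q0 l * X l) * lik (u n j) (v n j) (ω n) =
        (∑ j, q0 j * X j * lik (u n j) (v n j) (ω n)) / ∑ l, q0 l * X l := by
      rw [Finset.sum_div]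
      exact Finset.sum_congr rfl fun j _ => by ring
    have h₂ : ∑ j, q0 j * (X j * (lik (u n j) (v n j) (ω n) / lik (u n i) (v n i) (ω n))) =
        (∑ j, q0 j * X j * lik (u n j) (v n j) (ω n)) / lik (u n i) (v n i) (ω n) := by
      rw [Finset.sum_div]
      exact Finset.sum_congr rfl fun j _ => by ring
    change q0 k * X k / (∑ l, q0 l * X l) * lik (u n k) (v n k) (ω n) /
        ∑ j, q0 j * X j / (∑ l, q0 l * X l) * lik (u n j) (v n j) (ω n) =
      q0 k * (X k * (lik (u n k) (v n k) (ω n) / lik (u n i) (v n i) (ω n))) /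
        ∑ j, q0 j * (X j * (lik (u n j) (v n j) (ω n) / lik (u n i) (v n i) (ω n)))
    rw [h₁, h₂, div_mul_eq_mul_div, div_div_div_cancel_right₀ hS.ne', ← mul_div_assoc,
      ← mul_div_assoc, div_div_div_cancel_right₀ hi, mul_assoc]

/-- Proposition 1 (Convergence of Beliefs): under the product probability measure `P` whose
`n`-th coordinate distribution gives the outcome `y = (y^c, y^s)` probability
`σ(y^c·u_i^n)·σ(y^s·v_i^n)` (i.e. outcomes are drawn from model `i`), for every candidate
model `k` the sequence of posterior probabilities `(q_k^n(ω))_n` converges as `n → ∞` for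
`P`-almost every `ω`. -/
theorem posterior_beliefs_converge {K : ℕ} (hK : 1 ≤ K) (i : Fin K)
    (u v : ℕ → Fin K → ℝ)
    (P : Measure TLOmega) (hprob : IsProbabilityMeasure P)
    (hP : ∀ (n : ℕ) (s : Fin n → Bool × Bool),
      P {ω : TLOmega | ∀ m : Fin n, ω m = s m} =
        ∏ m : Fin n, ENNReal.ofReal (lik (u m i) (v m i) (s m)))
    (q0 : Fin K → ℝ) (hq0 : ∀ j, 0 < q0 j) (hsum : ∑ j, q0 j = 1) :
    ∀ k : Fin K, ∀ᵐ ω ∂P,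
      ∃ L : ℝ, Filter.Tendsto (fun n => qproc u v q0 n ω k) Filter.atTop (nhds L) := by
  intro k
  have hlim : ∀ᵐ ω ∂P, ∀ j, ∃ L, Filter.Tendsto (fun n => likelihoodRatio
      (fun m => lik (u m j) (v m j)) (fun m => lik (u m i) (v m i)) n ω) Filter.atTop (nhds L) :=
    ae_all_iff.2 fun j => ae_tendsto_likelihoodRatio (fun _ _ => lik_pos _ _ _)
      (fun _ => sum_lik _ _) (fun _ _ => (lik_pos _ _ _).le) hP
  filter_upwards [hlim] with ω hω
  choose L hL using hω
  have hL0 : ∀ j, 0 ≤ L j := fun j => ge_of_tendsto' (hL j) fun n =>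
    likelihoodRatio_nonneg (fun _ _ => (lik_pos _ _ _).le) (fun _ _ => lik_pos _ _ _) n ω
  have hLi : L i = 1 := by
    refine tendsto_nhds_unique (hL i) ?_
    simp only [likelihoodRatio_self (p := fun m => lik (u m i) (v m i))
      (fun _ _ => lik_pos _ _ _)]
    exact tendsto_const_nhds
  have hS : 0 < ∑ j, q0 j * L j :=
    Finset.sum_pos' (fun j _ => mul_nonneg (hq0 j).le (hL0 j))
      ⟨i, Finset.mem_univ i, by rw [hLi, mul_one]; exact hq0 i⟩
  refine ⟨q0 k * L k / ∑ j, q0 j * L j, ?_⟩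
  simp only [qproc_eq i u v hq0 hsum]
  exact ((hL k).const_mul _).div (tendsto_finsetSum _ fun j _ => (hL j).const_mul _) hS.ne'
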